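/- Let (R, 𝔪) be a Noetherian local ring with dim R > 0 and R/𝔪 infinite, let I be a proper ideal, let M be a finitely generated R-module, and let d ≥ 2 be an integer with dim_R M ≤ d. Set M̄ = M/(0 :_M I^∞). Then for a general element a ∈ I one has dim_R(M̄/aM̄) ≤ d−1 and j_d(I, M) = j_{d−1}(I, M̄/aM̄). -/

import Mathlib

open Filter

noncomputable section

/-- The length of a module, as the height of `⊤` in the submodule lattice. -/
def mLength (R M : Type*) [CommRing R] [AddCommGroup M] [Module R M] : ℕ∞ :=
  Order.height (⊤ : Submodule R M)

/-- The Krull dimension of a module, via the annihilator. -/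
def mDim (R M : Type*) [CommRing R] [AddCommGroup M] [Module R M] : WithBot ℕ∞ :=
  ringKrullDim (R ⧸ Module.annihilator R M)

/-- `H⁰_I(N)`: elements killed by a power of `I` (0-th local cohomology). -/
def H0 {R : Type*} [CommRing R] (I : Ideal R) (N : Type*) [AddCommGroup N] [Module R N] :
    Submodule R N :=
  ⨆ n : ℕ, Submodule.torsionBySet R N ((I ^ n : Ideal R) : Set R)

/-- `IⁿM/I^{n+1}M`, as a submodule of `M/I^{n+1}M`. -/
def gradedPiece {R : Type*} [CommRing R] (I : Ideal R) {M : Type*} [AddCommGroup M]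
    [Module R M] (n : ℕ) : Submodule R (M ⧸ (I ^ (n + 1) • ⊤ : Submodule R M)) :=
  Submodule.map (I ^ (n + 1) • ⊤ : Submodule R M).mkQ (I ^ n • ⊤ : Submodule R M)

/-- The `j`-multiplicity `j_d(I, M)`, defined as
`lim_n (d−1)!/n^(d−1) · length_R (H⁰_𝔪(IⁿM/I^{n+1}M))`. -/
def jMult {R : Type*} [CommRing R] (𝔪 I : Ideal R) (M : Type*) [AddCommGroup M]
    [Module R M] (d : ℕ) : ℝ :=
  limUnder atTop fun n : ℕ =>
    ((d - 1).factorial : ℝ) / (n : ℝ) ^ (d - 1) *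
      ((mLength R (H0 𝔪 (gradedPiece I (M := M) n))).toNat : ℝ)

/-- The Hilbert–Samuel multiplicity `e(I; N)` of a `d`-dimensional module `N`
(equal to `0` if `N = 0`), defined as `lim_n d!/n^d · length_R (N/IⁿN)`. -/
def hsMult {R : Type*} [CommRing R] (I : Ideal R) (N : Type*) [AddCommGroup N]
    [Module R N] (d : ℕ) : ℝ :=
  limUnder atTop fun n : ℕ =>
    (d.factorial : ℝ) / (n : ℝ) ^ d *
      ((mLength R (N ⧸ (I ^ n • ⊤ : Submodule R N))).toNat : ℝ)

/-- `K :_M I^∞ = ⋃ₙ (K :_M Iⁿ)`. -/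
def satur {R : Type*} [CommRing R] (I : Ideal R) {M : Type*} [AddCommGroup M] [Module R M]
    (K : Submodule R M) : Submodule R M :=
  Submodule.comap K.mkQ (H0 I (M ⧸ K))

/-- "For general elements `a₁, …, aᵢ` of `I`", i.e. for all `i`-tuples of elements of `I`
whose coefficient vectors with respect to any finite generating set of `I` avoid the zero
locus of some nonzero polynomial over the residue field `R/𝔪` (equivalently, whose images
lie in a suitable nonempty Zariski-open set of choices modulo `𝔪I`), property `P` holds. -/
def GeneralElts {R : Type*} [CommRing R] (𝔪 I : Ideal R) (i : ℕ)
    (P : (Fin i → R) → Prop) : Prop :=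
  ∀ (m : ℕ) (x : Fin m → R), Ideal.span (Set.range x) = I →
    ∃ F : MvPolynomial (Fin i × Fin m) R,
      MvPolynomial.map (Ideal.Quotient.mk 𝔪) F ≠ 0 ∧
      ∀ c : Fin i × Fin m → R,
        MvPolynomial.eval (fun p => Ideal.Quotient.mk 𝔪 (c p))
          (MvPolynomial.map (Ideal.Quotient.mk 𝔪) F) ≠ 0 →
        P fun j => ∑ l, c (j, l) * x l

/-- A property of coefficient vectors `c ∈ Rᵐ` that holds whenever the reduction of `c` modulo the
maximal ideal avoids the zero locus of some nonzero polynomial. -/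
def Generic {R : Type*} [CommRing R] [IsLocalRing R] {m : ℕ} (P : (Fin m → R) → Prop) : Prop :=
  ∃ F : MvPolynomial (Fin m) R,
    MvPolynomial.map (Ideal.Quotient.mk (IsLocalRing.maximalIdeal R)) F ≠ 0 ∧
    ∀ c : Fin m → R,
      MvPolynomial.eval (fun p => Ideal.Quotient.mk (IsLocalRing.maximalIdeal R) (c p))
        (MvPolynomial.map (Ideal.Quotient.mk (IsLocalRing.maximalIdeal R)) F) ≠ 0 → P c

namespace Generic

variable {R : Type*} [CommRing R] [IsLocalRing R] {m : ℕ}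

lemma mono {P Q : (Fin m → R) → Prop} (h : Generic P) (hPQ : ∀ c, P c → Q c) : Generic Q := by
  obtain ⟨F, hF, h⟩ := h
  exact ⟨F, hF, fun c hc => hPQ c (h c hc)⟩

lemma of_forall {P : (Fin m → R) → Prop} (h : ∀ c, P c) : Generic P :=
  ⟨1, by simp, fun c _ => h c⟩

lemma and {P Q : (Fin m → R) → Prop} (hP : Generic P) (hQ : Generic Q) :
    Generic fun c => P c ∧ Q c := by
  obtain ⟨F, hF, hP⟩ := hP
  obtain ⟨G, hG, hQ⟩ := hQ
  refine ⟨F * G, ?_, fun c hc => ?_⟩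
  · rw [map_mul]
    exact mul_ne_zero hF hG
  · rw [map_mul, map_mul] at hc
    exact ⟨hP c (left_ne_zero_of_mul hc), hQ c (right_ne_zero_of_mul hc)⟩

lemma forall_mem_finset {ι : Type*} (s : Finset ι) {P : ι → (Fin m → R) → Prop}
    (h : ∀ i ∈ s, Generic (P i)) : Generic fun c => ∀ i ∈ s, P i c := by
  classical
  induction s using Finset.induction_on with
  | empty => exact of_forall (by simp)
  | insert i s _ ih =>
    refine ((h i (by simp)).and (ih fun j hj => h j (by simp [hj]))).mono fun c hc => ?_
    simpa using hc

lemma exists_of_infinite [Infinite (IsLocalRing.ResidueField R)] {P : (Fin m → R) → Prop}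
    (h : Generic P) : ∃ c, P c := by
  obtain ⟨F, hF, h⟩ := h
  have : Infinite (R ⧸ IsLocalRing.maximalIdeal R) := ‹_›
  by_contra! hP
  refine hF (MvPolynomial.funext fun c => ?_)
  choose c' hc' using fun l => Ideal.Quotient.mk_surjective (c l)
  by_contra hne
  refine hP c' (h c' ?_)
  simpa [hc'] using hne

lemma notMem {W : Submodule R (Fin m → R)} (hW : W ≠ ⊤) : Generic fun c => c ∉ W := by
  obtain ⟨U, hU, hWU⟩ := (eq_top_or_exists_le_coatom W).resolve_left hW
  have : IsSimpleModule R ((Fin m → R) ⧸ U) := isSimpleModule_iff_isCoatom.mpr hU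
  obtain ⟨J, hJ, ⟨e⟩⟩ := isSimpleModule_iff_quot_maximal.mp this
  obtain rfl := IsLocalRing.eq_maximalIdeal hJ
  let f : (Fin m → R) →ₗ[R] R ⧸ IsLocalRing.maximalIdeal R := e.toLinearMap ∘ₗ U.mkQ
  have hfU (c) (hc : c ∈ U) : f c = 0 := by
    simp [f, (Submodule.Quotient.mk_eq_zero U).mpr hc]
  choose r hr using fun l => Ideal.Quotient.mk_surjective (f (Pi.single l 1))
  have hf (c) : MvPolynomial.eval (fun p => Ideal.Quotient.mk (IsLocalRing.maximalIdeal R) (c p))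
      (MvPolynomial.map (Ideal.Quotient.mk (IsLocalRing.maximalIdeal R))
        (∑ l, MvPolynomial.C (r l) * MvPolynomial.X l)) = f c := by
    conv_rhs => rw [← Finset.univ_sum_single c]
    simp only [map_sum, map_mul, MvPolynomial.map_C, MvPolynomial.map_X, MvPolynomial.eval_C,
      MvPolynomial.eval_X, hr]
    refine Finset.sum_congr rfl fun l _ => ?_
    have : (Pi.single l (c l) : Fin m → R) = c l • Pi.single l 1 := by
      rw [← Pi.single_smul, smul_eq_mul, mul_one]
    rw [this, f.map_smul, Algebra.smul_def, mul_comm, Ideal.Quotient.algebraMap_eq]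
  refine ⟨∑ l, MvPolynomial.C (r l) * MvPolynomial.X l,
    fun h0 => hU.1 (Submodule.eq_top_iff'.mpr fun c => ?_), fun c hc hcW => hc ?_⟩
  · have := hf c
    rw [h0, map_zero] at this
    simpa [f] using this.symm
  · rw [hf, hfU c (hWU hcW)]

/-- A general linear form in `y₁, …, yₘ` is filter-regular with respect to `(y₁, …, yₘ)`. -/
lemma filterRegular {A W : Type*} [CommRing A] [IsNoetherianRing A] [Algebra R A]
    [AddCommGroup W] [Module A W] (P D : Submodule A W) (hP : P.FG) (y : Fin m → A) :
    Generic fun c : Fin m → R => ∃ n₀, ∀ n ≥ n₀, ∀ z ∈ Ideal.span (Set.range y) ^ n • P,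
      (∑ l, algebraMap R A (c l) * y l) • z ∈ D → z ∈ D := by
  classical
  set Y := Ideal.span (Set.range y)
  let Q := P.map D.mkQ
  have : Module.Finite A Q := Module.Finite.iff_fg.mpr (hP.map _)
  let φ : (Fin m → R) →ₗ[R] A := ∑ l, (LinearMap.toSpanSingleton R A (y l)) ∘ₗ LinearMap.proj l
  have hφ (c) : φ c = ∑ l, algebraMap R A (c l) * y l := by
    simp [φ, Algebra.smul_def]
  have hfin := associatedPrimes.finite A Q
  refine (forall_mem_finset (hfin.toFinset.filter fun p => ¬ Y ≤ p)
    (P := fun p c => φ c ∉ p) fun p hp => ?_).mono fun c hc => ?_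
  · refine notMem (W := (p.restrictScalars R).comap φ) fun htop => ?_
    rw [Finset.mem_filter] at hp
    refine hp.2 (Ideal.span_le.mpr ?_)
    rintro _ ⟨l, rfl⟩
    have : Pi.single l 1 ∈ (p.restrictScalars R).comap φ := htop ▸ Submodule.mem_top
    simpa [φ, Pi.single_apply, Finset.sum_ite_eq] using this
  · rw [← hφ]
    set a := φ c
    let K : Submodule A Q := Submodule.torsionBy A Q a
    have hYK : Y ≤ (Module.annihilator A K).radical := by
      rw [Ideal.radical_eq_sInf]
      refine le_sInf fun q ⟨hq, hqp⟩ => ?_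
      obtain ⟨p, hp, hpq⟩ := Ideal.exists_minimalPrimes_le hq
      refine le_trans ?_ hpq
      by_contra hYp
      refine hc p ?_ (hp.1.2 ?_)
      · simp only [Finset.mem_filter, Set.Finite.mem_toFinset]
        exact ⟨associatedPrimes.subset_of_injective K.injective_subtype
          (Module.associatedPrimes.minimalPrimes_annihilator_subset_associatedPrimes A K hp), hYp⟩
      · rw [Module.mem_annihilator]
        intro k
        exact Submodule.smul_torsionBy a k
    obtain ⟨t, ht⟩ := Ideal.exists_pow_le_of_le_radical_of_fg hYK (IsNoetherian.noetherian Y)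
    obtain ⟨k, hk⟩ := Ideal.exists_pow_inf_eq_pow_smul Y K
    refine ⟨k + t, fun n hn z hz haz => ?_⟩
    have hzP : z ∈ P := Submodule.smul_le_right hz
    let q : Q := ⟨D.mkQ z, Submodule.mem_map_of_mem hzP⟩
    have hqK : q ∈ K := by
      rw [Submodule.mem_torsionBy_iff]
      ext
      simpa [q] using (Submodule.Quotient.mk_eq_zero D).mpr haz
    have hqn : q ∈ Y ^ n • (⊤ : Submodule A Q) := by
      have h1 : (Y ^ n • (⊤ : Submodule A Q)).map Q.subtype = (Y ^ n • P).map D.mkQ := by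
        simp [Submodule.map_smul'', Q]
      have h2 : Q.subtype q ∈ (Y ^ n • (⊤ : Submodule A Q)).map Q.subtype := by
        rw [h1]
        exact Submodule.mem_map_of_mem hz
      obtain ⟨q', hq', he⟩ := h2
      exact Q.injective_subtype he ▸ hq'
    have hq0 : q ∈ (⊥ : Submodule A Q) := by
      have h1 : q ∈ Y ^ n • ⊤ ⊓ K := ⟨hqn, hqK⟩
      rw [hk n (by omega)] at h1
      have h2 : Y ^ (n - k) • (Y ^ k • ⊤ ⊓ K) ≤ (⊥ : Submodule A Q) := by
        refine Submodule.smul_le.mpr fun r hr w hw => ?_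
        have := Module.mem_annihilator.mp (ht (Ideal.pow_le_pow_right (by omega) hr)) ⟨w, hw.2⟩
        simpa using congrArg Subtype.val this
      exact h2 h1
    have := congrArg Subtype.val ((Submodule.mem_bot A).mp hq0)
    exact (Submodule.Quotient.mk_eq_zero D).mp this

end Generic

section Filtration

variable {R N : Type*} [CommRing R] [AddCommGroup N] [Module R N] {I : Ideal R}

lemma single_mem_submodule_iff (F : I.Filtration N) (n : ℕ) (z : N) :
    PolynomialModule.single R n z ∈ F.submodule ↔ z ∈ F.N n := by
  classical
  rw [Ideal.Filtration.mem_submodule]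
  refine ⟨fun h => by simpa using h n, fun h i => ?_⟩
  rw [PolynomialModule.coeff_single, Finsupp.single_apply]
  split_ifs with hi
  · exact hi ▸ h
  · exact zero_mem _

/-- The element `r T` of the Rees algebra `R[IT]`, for `r ∈ I`. -/
def reesDegreeOne (r : I) : reesAlgebra I :=
  ⟨Polynomial.monomial 1 (r : R), reesAlgebra.monomial_mem.mpr (by simp)⟩

lemma reesDegreeOne_smul_single (r : I) (n : ℕ) (z : N) :
    reesDegreeOne r • PolynomialModule.single R n z =
      PolynomialModule.single R (n + 1) ((r : R) • z) := by
  rw [Subalgebra.smul_def, reesDegreeOne, PolynomialModule.monomial_smul_single, add_comm]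

lemma algebraMap_rees_smul_single (r : R) (n : ℕ) (z : N) :
    algebraMap R (reesAlgebra I) r • PolynomialModule.single R n z =
      PolynomialModule.single R n (r • z) := by
  rw [Subalgebra.smul_def, Subalgebra.coe_algebraMap, Polynomial.algebraMap_eq,
    ← Polynomial.monomial_zero_left, PolynomialModule.monomial_smul_single, zero_add]

lemma reesDegreeOne_mem_span {m : ℕ} (u : Fin m → I)
    (hu : Ideal.span (Set.range fun l => (u l : R)) = I) (r : I) :
    reesDegreeOne r ∈ Ideal.span (Set.range fun l => reesDegreeOne (u l)) := by
  have hr : (r : R) ∈ Ideal.span (Set.range fun l => (u l : R)) := hu.ge r.2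
  obtain ⟨c, hc⟩ := (Submodule.mem_span_range_iff_exists_fun R).mp hr
  have : reesDegreeOne r = ∑ l, algebraMap R (reesAlgebra I) (c l) * reesDegreeOne (u l) := by
    apply Subtype.ext
    simp [reesDegreeOne, ← hc, Polynomial.C_mul_monomial]
  rw [this]
  exact Ideal.sum_mem _ fun l _ => Ideal.mul_mem_left _ _ (Ideal.subset_span ⟨l, rfl⟩)

lemma single_mem_pow_smul {m : ℕ} (u : Fin m → I)
    (hu : Ideal.span (Set.range fun l => (u l : R)) = I) (n : ℕ) (z : N)
    (hz : z ∈ I ^ n • (⊤ : Submodule R N)) :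
    PolynomialModule.single R n z ∈ Ideal.span (Set.range fun l => reesDegreeOne (u l)) ^ n •
      (I.stableFiltration (⊤ : Submodule R N)).submodule := by
  induction n generalizing z with
  | zero =>
    rw [pow_zero, Ideal.one_eq_top, Submodule.top_smul, single_mem_submodule_iff]
    simp
  | succ n ih =>
    rw [pow_succ', Submodule.mul_smul] at hz
    induction hz using Submodule.smul_induction_on' with
    | smul r hr w hw =>
      rw [← reesDegreeOne_smul_single ⟨r, hr⟩, pow_succ', Submodule.mul_smul]
      exact Submodule.smul_mem_smul (reesDegreeOne_mem_span u hu _) (ih w hw)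
    | add x _ y _ hx hy =>
      rw [PolynomialModule.single_add]
      exact add_mem hx hy

variable [IsNoetherianRing R] [Module.Finite R N]

lemma stableFiltration_top_submodule_fg (I : Ideal R) :
    (I.stableFiltration (⊤ : Submodule R N)).submodule.FG :=
  (Ideal.Filtration.submodule_fg_iff_stable _ fun _ => IsNoetherian.noetherian _).mpr
    (I.stableFiltration_stable ⊤)

variable [IsLocalRing R]

/-- Multiplication by a general element of `I` is injective in large degrees on
`⨁ₙ IⁿN / (IⁿN ∩ Fₙ)`. -/
lemma Ideal.Filtration.generic_mem_of_smul_mem (F : I.Filtration N) {m : ℕ} (u : Fin m → R)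
    (hu : Ideal.span (Set.range u) = I) :
    Generic fun c : Fin m → R => ∃ n₀, ∀ n ≥ n₀, ∀ z ∈ I ^ n • (⊤ : Submodule R N),
      (∑ l, c l * u l) • z ∈ F.N (n + 1) → z ∈ F.N n := by
  let u' : Fin m → I := fun l => ⟨u l, hu ▸ Ideal.subset_span ⟨l, rfl⟩⟩
  refine (Generic.filterRegular (R := R) (I.stableFiltration (⊤ : Submodule R N)).submodule F.submodule
    (stableFiltration_top_submodule_fg I) fun l => reesDegreeOne (u' l)).mono ?_
  rintro c ⟨n₀, h⟩
  refine ⟨n₀, fun n hn z hz haz => ?_⟩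
  rw [← single_mem_submodule_iff]
  refine h n hn _ (single_mem_pow_smul u' hu n z hz) ?_
  have : ∑ l, algebraMap R (reesAlgebra I) (c l) * reesDegreeOne (u' l) =
      reesDegreeOne ⟨∑ l, c l * u l, Ideal.sum_mem _ fun l _ => Ideal.mul_mem_left _ _ (u' l).2⟩ := by
    apply Subtype.ext
    simp [reesDegreeOne, u', Polynomial.C_mul_monomial]
  rw [this, reesDegreeOne_smul_single, single_mem_submodule_iff]
  exact haz

/-- Some element of `J` is filter-regular with respect to `J` on `⨁ₙ IⁿN / (IⁿN ∩ Fₙ)`. -/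
lemma Ideal.Filtration.exists_mem_forall_smul_mem [Infinite (IsLocalRing.ResidueField R)]
    (F : I.Filtration N) (J : Ideal R) :
    ∃ b ∈ J, ∃ t, ∀ n, ∀ z ∈ I ^ n • (⊤ : Submodule R N), b • z ∈ F.N n →
      ∀ r ∈ J ^ t, r • z ∈ F.N n := by
  obtain ⟨m, u, hu⟩ := Submodule.fg_iff_exists_fin_generating_family.mp
    (IsNoetherian.noetherian J)
  obtain ⟨c, t, h⟩ := (Generic.filterRegular (R := R) (I.stableFiltration (⊤ : Submodule R N)).submodule
    F.submodule (stableFiltration_top_submodule_fg I)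
    fun l => algebraMap R (reesAlgebra I) (u l)).exists_of_infinite
  have hY : Ideal.span (Set.range fun l => algebraMap R (reesAlgebra I) (u l)) =
      J.map (algebraMap R (reesAlgebra I)) := by
    rw [← hu, Ideal.submodule_span_eq, Ideal.map_span, ← Set.range_comp]
    rfl
  refine ⟨∑ l, c l * u l, ?_, t, fun n z hz hbz r hr => ?_⟩
  · exact Ideal.sum_mem _ fun l _ => Ideal.mul_mem_left _ _ (hu ▸ Ideal.subset_span ⟨l, rfl⟩)
  · rw [← single_mem_submodule_iff, ← algebraMap_rees_smul_single]
    refine h t le_rfl _ ?_ ?_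
    · rw [hY, ← Ideal.map_pow]
      refine Submodule.smul_mem_smul (Ideal.mem_map_of_mem _ hr) ?_
      rw [single_mem_submodule_iff]
      exact hz
    · simp only [← map_mul, ← map_sum]
      rw [smul_comm, algebraMap_rees_smul_single]
      refine Submodule.smul_mem _ _ ?_
      rw [single_mem_submodule_iff]
      exact hbz

end Filtration

section LocalCohomology

variable {R P P' P'' : Type*} [CommRing R] [AddCommGroup P] [Module R P] [AddCommGroup P']
  [Module R P'] [AddCommGroup P''] [Module R P'']

lemma mem_H0_iff {J : Ideal R} {x : P} : x ∈ H0 J P ↔ ∃ k, ∀ r ∈ J ^ k, r • x = 0 := by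
  have hdir : Directed (· ≤ ·)
      fun n : ℕ => Submodule.torsionBySet R P ((J ^ n : Ideal R) : Set R) := by
    refine Monotone.directed_le (monotone_nat_of_le_succ fun n => ?_)
    exact Submodule.torsionBySet_le_torsionBySet_of_subset (Ideal.pow_le_pow_right n.le_succ)
  rw [H0, Submodule.mem_iSup_of_directed _ hdir]
  simp [Submodule.mem_torsionBySet_iff]

lemma mem_satur_iff {J : Ideal R} {K : Submodule R P} {x : P} :
    x ∈ satur J K ↔ ∃ k, ∀ r ∈ J ^ k, r • x ∈ K := by
  rw [satur, Submodule.mem_comap, mem_H0_iff]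
  simp only [Submodule.mkQ_apply, ← Submodule.Quotient.mk_smul, Submodule.Quotient.mk_eq_zero]

lemma le_satur (J : Ideal R) (K : Submodule R P) : K ≤ satur J K :=
  fun _ hx => mem_satur_iff.mpr ⟨0, fun r _ => K.smul_mem r hx⟩

lemma satur_mono (J : Ideal R) {K L : Submodule R P} (h : K ≤ L) : satur J K ≤ satur J L :=
  fun _ hx => by
    obtain ⟨k, hk⟩ := mem_satur_iff.mp hx
    exact mem_satur_iff.mpr ⟨k, fun r hr => h (hk r hr)⟩

lemma mem_satur_of_forall_smul_mem_satur [IsNoetherianRing R] {J : Ideal R} {K : Submodule R P}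
    {x : P} (t : ℕ) (h : ∀ r ∈ J ^ t, r • x ∈ satur J K) : x ∈ satur J K := by
  classical
  obtain ⟨s, hs⟩ := IsNoetherian.noetherian (J ^ t)
  choose! k hk using fun r (hr : r ∈ J ^ t) => mem_satur_iff.mp (h r hr)
  refine mem_satur_iff.mpr ⟨s.sup k + t, fun r hr => ?_⟩
  rw [pow_add, ← hs] at hr
  induction hr using Submodule.mul_induction_on' with
  | mem_mul_mem p hp q hq =>
    induction hq using Submodule.span_induction with
    | mem q hq =>
      rw [mul_smul]
      exact hk q (hs ▸ Submodule.subset_span hq) p (Ideal.pow_le_pow_right (Finset.le_sup hq) hp)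
    | zero => simp
    | add x y _ _ hx hy =>
      rw [mul_add, add_smul]
      exact add_mem hx hy
    | smul c x _ hx =>
      rw [smul_eq_mul, mul_left_comm, mul_smul]
      exact K.smul_mem c hx
  | add a _ b _ ha hb =>
    rw [add_smul]
    exact add_mem ha hb

lemma map_mem_H0 {J : Ideal R} (f : P →ₗ[R] P') {x : P} (hx : x ∈ H0 J P) : f x ∈ H0 J P' := by
  obtain ⟨k, hk⟩ := mem_H0_iff.mp hx
  exact mem_H0_iff.mpr ⟨k, fun r hr => by rw [← map_smul, hk r hr, map_zero]⟩

lemma mLength_eq_length (P : Type*) [AddCommGroup P] [Module R P] :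
    mLength R P = Module.length R P :=
  (Module.length_eq_height R P).symm

lemma mLength_H0_eq_add (J : Ideal R) (f : P →ₗ[R] P') (g : P' →ₗ[R] P'')
    (hf : Function.Injective f) (hfg : Function.Exact f g)
    (hg : ∀ y ∈ H0 J P'', ∃ x ∈ H0 J P', g x = y) :
    mLength R (H0 J P') = mLength R (H0 J P) + mLength R (H0 J P'') := by
  simp only [mLength_eq_length]
  refine Module.length_eq_add_of_exact (f.restrict fun x hx => map_mem_H0 f hx)
    (g.restrict fun x hx => map_mem_H0 g hx) (fun x y hxy => ?_) (fun y => ?_) (fun y => ?_)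
  · exact Subtype.ext (hf (congrArg Subtype.val hxy))
  · obtain ⟨x, hx, hxy⟩ := hg y y.2
    exact ⟨⟨x, hx⟩, Subtype.ext hxy⟩
  · constructor
    · intro hy
      obtain ⟨x, hx⟩ := (hfg y).mp (congrArg Subtype.val hy)
      refine ⟨⟨x, ?_⟩, Subtype.ext hx⟩
      obtain ⟨k, hk⟩ := mem_H0_iff.mp y.2
      exact mem_H0_iff.mpr ⟨k, fun r hr => hf (by rw [map_smul, hx, hk r hr, map_zero])⟩
    · rintro ⟨x, rfl⟩
      exact Subtype.ext ((hfg _).mpr ⟨x, rfl⟩)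

lemma mLength_H0_congr (J : Ideal R) (e : P ≃ₗ[R] P') :
    mLength R (H0 J P) = mLength R (H0 J P') := by
  have h := mLength_H0_eq_add (P'' := PUnit.{1}) J e.toLinearMap 0 e.injective
    (fun y => by simp) (fun y _ => ⟨0, zero_mem _, rfl⟩)
  rw [h, mLength_eq_length (H0 J PUnit.{1}), Module.length_eq_zero, add_zero]

lemma exists_pow_smul_H0_eq_zero [IsNoetherianRing R] [Module.Finite R P] (J : Ideal R) :
    ∃ k, ∀ r ∈ J ^ k, ∀ x ∈ H0 J P, r • x = 0 := by
  classical
  obtain ⟨s, hs⟩ := IsNoetherian.noetherian (H0 J P)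
  choose! k hk using fun x (hx : x ∈ H0 J P) => mem_H0_iff.mp hx
  refine ⟨s.sup k, fun r hr x hx => ?_⟩
  have : H0 J P ≤ Submodule.torsionBy R P r := by
    rw [← hs, Submodule.span_le]
    intro y hy
    exact (Submodule.mem_torsionBy_iff _ _).mpr
      (hk y (hs ▸ Submodule.subset_span hy) r (Ideal.pow_le_pow_right (Finset.le_sup hy) hr))
  exact (Submodule.mem_torsionBy_iff _ _).mp (this hx)

lemma mLength_H0_ne_top [IsNoetherianRing R] [IsLocalRing R] [Module.Finite R P] :
    mLength R (H0 (IsLocalRing.maximalIdeal R) P) ≠ ⊤ := by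
  set 𝔪 := IsLocalRing.maximalIdeal R
  rw [mLength_eq_length]
  obtain ⟨k, hk⟩ := exists_pow_smul_H0_eq_zero (P := P) 𝔪
  have hann : 𝔪 ^ k ≤ Module.annihilator R (H0 𝔪 P) := fun r hr =>
    Module.mem_annihilator.mpr fun x => Subtype.ext (hk r hr x x.2)
  have hart : IsArtinianRing (R ⧸ Module.annihilator R (H0 𝔪 P)) := by
    rw [isArtinianRing_iff_krullDimLE_zero, Ring.krullDimLE_zero_iff]
    intro p hp
    have hle : 𝔪 ≤ p.comap (Ideal.Quotient.mk _) :=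
      Ideal.IsPrime.le_of_pow_le (hann.trans fun r hr => by
        rw [Ideal.mem_comap, Ideal.Quotient.eq_zero_iff_mem.mpr hr]
        exact zero_mem p)
    have hmax : (p.comap (Ideal.Quotient.mk (Module.annihilator R (H0 𝔪 P)))).IsMaximal :=
      (IsLocalRing.maximalIdeal.isMaximal R).eq_of_le (Ideal.IsPrime.ne_top inferInstance) hle ▸
        IsLocalRing.maximalIdeal.isMaximal R
    rw [← Ideal.map_comap_of_surjective _ Ideal.Quotient.mk_surjective p]
    refine (Ideal.map_eq_top_or_isMaximal_of_surjective _ Ideal.Quotient.mk_surjective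
      hmax).resolve_left ?_
    rw [Ideal.map_comap_of_surjective _ Ideal.Quotient.mk_surjective p]
    exact hp.ne_top
  let : Module (R ⧸ Module.annihilator R (H0 𝔪 P)) (H0 𝔪 P) := Module.quotientAnnihilator
  have : IsScalarTower R (R ⧸ Module.annihilator R (H0 𝔪 P)) (H0 𝔪 P) :=
    Module.IsTorsionBySet.isScalarTower (Module.isTorsionBySet_annihilator R (H0 𝔪 P))
  have : Module.Finite (R ⧸ Module.annihilator R (H0 𝔪 P)) (H0 𝔪 P) :=
    Module.Finite.of_restrictScalars_finite R _ _
  have : IsArtinian R (H0 𝔪 P) := isArtinian_of_surjective_algebraMap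
    (R := R ⧸ Module.annihilator R (H0 𝔪 P)) Ideal.Quotient.mk_surjective
  exact Module.length_ne_top

end LocalCohomology

section GradedPiece

variable {R N N' : Type*} [CommRing R] [AddCommGroup N] [Module R N] [AddCommGroup N']
  [Module R N'] {I : Ideal R} {n k : ℕ}

/-- The class in `IⁿN/Iⁿ⁺¹N` of an element of `IⁿN`. -/
def gradedPiece.mk (z : N) (hz : z ∈ I ^ n • (⊤ : Submodule R N)) : gradedPiece I (M := N) n :=
  ⟨Submodule.mkQ _ z, Submodule.mem_map_of_mem hz⟩

lemma gradedPiece.mk_surjective (g : gradedPiece I (M := N) n) :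
    ∃ z hz, gradedPiece.mk z hz = g := by
  obtain ⟨_, z, hz, rfl⟩ := g
  exact ⟨z, hz, rfl⟩

lemma gradedPiece.smul_mk (r : R) (z : N) (hz : z ∈ I ^ n • (⊤ : Submodule R N)) :
    r • gradedPiece.mk z hz = gradedPiece.mk (r • z) (Submodule.smul_mem _ r hz) :=
  rfl

lemma gradedPiece.mk_eq_mk_iff {z w : N} {hz : z ∈ I ^ n • (⊤ : Submodule R N)}
    {hw : w ∈ I ^ n • (⊤ : Submodule R N)} :
    gradedPiece.mk z hz = gradedPiece.mk w hw ↔ z - w ∈ I ^ (n + 1) • (⊤ : Submodule R N) := by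
  exact Subtype.ext_iff.trans (Submodule.Quotient.eq _)

lemma gradedPiece.mk_eq_zero_iff {z : N} {hz : z ∈ I ^ n • (⊤ : Submodule R N)} :
    gradedPiece.mk z hz = 0 ↔ z ∈ I ^ (n + 1) • (⊤ : Submodule R N) := by
  exact Subtype.ext_iff.trans (Submodule.Quotient.mk_eq_zero _)

lemma gradedPiece.mk_mem_H0_iff {J : Ideal R} {z : N} {hz : z ∈ I ^ n • (⊤ : Submodule R N)} :
    gradedPiece.mk z hz ∈ H0 J (gradedPiece I (M := N) n) ↔
      z ∈ satur J (I ^ (n + 1) • (⊤ : Submodule R N)) := by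
  simp only [mem_H0_iff, mem_satur_iff, smul_mk, mk_eq_zero_iff]

/-- The map `IⁿN/Iⁿ⁺¹N → IᵏN'/Iᵏ⁺¹N'` induced by a linear map `N → N'`. -/
def gradedPiece.map (φ : N →ₗ[R] N')
    (h₀ : ∀ z ∈ I ^ n • (⊤ : Submodule R N), φ z ∈ I ^ k • (⊤ : Submodule R N'))
    (h₁ : ∀ z ∈ I ^ (n + 1) • (⊤ : Submodule R N), φ z ∈ I ^ (k + 1) • (⊤ : Submodule R N')) :
    gradedPiece I (M := N) n →ₗ[R] gradedPiece I (M := N') k :=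
  (Submodule.mapQ _ _ φ h₁).restrict (by
    rintro _ ⟨z, hz, rfl⟩
    exact Submodule.mem_map_of_mem (h₀ z hz))

lemma gradedPiece.map_mk (φ : N →ₗ[R] N')
    (h₀ : ∀ z ∈ I ^ n • (⊤ : Submodule R N), φ z ∈ I ^ k • (⊤ : Submodule R N'))
    (h₁ : ∀ z ∈ I ^ (n + 1) • (⊤ : Submodule R N), φ z ∈ I ^ (k + 1) • (⊤ : Submodule R N'))
    (z : N) (hz : z ∈ I ^ n • (⊤ : Submodule R N)) :
    gradedPiece.map φ h₀ h₁ (gradedPiece.mk z hz) = gradedPiece.mk (φ z) (h₀ z hz) :=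
  rfl

lemma map_mem_pow_smul_top (φ : N →ₗ[R] N') (n : ℕ) (z : N)
    (hz : z ∈ I ^ n • (⊤ : Submodule R N)) : φ z ∈ I ^ n • (⊤ : Submodule R N') := by
  have := Submodule.mem_map_of_mem (f := φ) hz
  rw [Submodule.map_smul''] at this
  exact (Submodule.smul_mono le_rfl le_top : I ^ n • Submodule.map φ ⊤ ≤ I ^ n • ⊤) this

lemma exists_mem_pow_smul_of_mkQ (K : Submodule R N) (z : N ⧸ K)
    (hz : z ∈ I ^ n • (⊤ : Submodule R (N ⧸ K))) :
    ∃ w ∈ I ^ n • (⊤ : Submodule R N), K.mkQ w = z := by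
  have h : (I ^ n • (⊤ : Submodule R N)).map K.mkQ = I ^ n • ⊤ := by
    rw [Submodule.map_smul'', Submodule.map_top, Submodule.range_mkQ]
  rw [← h] at hz
  exact hz

lemma mkQ_mem_pow_smul_iff (K : Submodule R N) (z : N) :
    K.mkQ z ∈ I ^ n • (⊤ : Submodule R (N ⧸ K)) ↔ ∃ w ∈ I ^ n • (⊤ : Submodule R N), z - w ∈ K := by
  constructor
  · intro hz
    obtain ⟨w, hw, h⟩ := exists_mem_pow_smul_of_mkQ K _ hz
    exact ⟨w, hw, (Submodule.Quotient.eq K).mp h.symm⟩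
  · rintro ⟨w, hw, h⟩
    rw [show K.mkQ z = K.mkQ w from (Submodule.Quotient.eq K).mpr h]
    exact map_mem_pow_smul_top _ _ _ hw

/-- The length of `H⁰_J(IⁿP/Iⁿ⁺¹P)`. -/
def h0Length (J I : Ideal R) (P : Type*) [AddCommGroup P] [Module R P] (n : ℕ) : ℕ∞ :=
  mLength R (H0 J (gradedPiece I (M := P) n))

end GradedPiece

section Superficial

variable {R N : Type*} [CommRing R] [AddCommGroup N] [Module R N] {I : Ideal R} {a : R}

lemma pow_smul_top_mono {i j : ℕ} (h : i ≤ j) :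
    I ^ j • (⊤ : Submodule R N) ≤ I ^ i • (⊤ : Submodule R N) :=
  Submodule.smul_mono_left (Ideal.pow_le_pow_right h)

lemma smul_mem_pow_succ_smul {r : R} (hr : r ∈ I) {n : ℕ} {z : N}
    (hz : z ∈ I ^ n • (⊤ : Submodule R N)) : r • z ∈ I ^ (n + 1) • (⊤ : Submodule R N) := by
  rw [pow_succ', Submodule.mul_smul]
  exact Submodule.smul_mem_smul hr hz

lemma smul_mem_satur_pow_succ {J : Ideal R} {r : R} (hr : r ∈ I) {n : ℕ} {z : N}
    (hz : z ∈ satur J (I ^ n • (⊤ : Submodule R N))) :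
    r • z ∈ satur J (I ^ (n + 1) • (⊤ : Submodule R N)) := by
  obtain ⟨k, hk⟩ := mem_satur_iff.mp hz
  refine mem_satur_iff.mpr ⟨k, fun s hs => ?_⟩
  rw [smul_comm]
  exact smul_mem_pow_succ_smul hr (hk s hs)

/-- The filtration `(Iⁿ⁺¹N)ₙ`. -/
def succFiltration (I : Ideal R) (N : Type*) [AddCommGroup N] [Module R N]
    : I.Filtration N where
  N n := I ^ (n + 1) • ⊤
  mono _ := pow_smul_top_mono (by omega)
  smul_le _ := Submodule.smul_le.mpr fun _ hr _ hz => smul_mem_pow_succ_smul hr hz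

/-- The filtration `(Iⁿ⁺¹N :_N J^∞)ₙ`. -/
def saturFiltration (I : Ideal R) (N : Type*) [AddCommGroup N] [Module R N]
    (J : Ideal R) : I.Filtration N where
  N n := satur J (I ^ (n + 1) • ⊤)
  mono _ := satur_mono J (pow_smul_top_mono (by omega))
  smul_le _ := Submodule.smul_le.mpr fun _ hr _ hz => smul_mem_satur_pow_succ hr hz

/-- The filtration `(b IⁿN + (Iⁿ⁺¹N :_N J^∞))ₙ`. -/
def saturSupFiltration (I : Ideal R) (N : Type*) [AddCommGroup N] [Module R N]
    (J : Ideal R) (b : R) : I.Filtration N where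
  N n := (I ^ n • ⊤ : Submodule R N).map (LinearMap.lsmul R N b) ⊔ satur J (I ^ (n + 1) • ⊤)
  mono n := sup_le_sup (Submodule.map_mono (pow_smul_top_mono n.le_succ))
    (satur_mono J (pow_smul_top_mono (by omega)))
  smul_le n := by
    refine Submodule.smul_le.mpr fun r hr z hz => ?_
    obtain ⟨_, ⟨v, hv, rfl⟩, w, hw, rfl⟩ := Submodule.mem_sup.mp hz
    rw [smul_add, ← map_smul]
    exact add_mem (Submodule.mem_sup_left ⟨_, smul_mem_pow_succ_smul hr hv, rfl⟩)
      (Submodule.mem_sup_right (smul_mem_satur_pow_succ hr hw))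

/-- `a` is filter-regular on the associated graded module of `N`: multiplication by `a` from
`IⁿN/Iⁿ⁺¹N` to `Iⁿ⁺¹N/Iⁿ⁺²N` is injective for all large `n`. -/
def IsFilterRegular (I : Ideal R) (N : Type*) [AddCommGroup N] [Module R N] (a : R) : Prop :=
  ∃ n₀, ∀ n ≥ n₀, ∀ z ∈ I ^ n • (⊤ : Submodule R N),
    a • z ∈ I ^ (n + 2) • (⊤ : Submodule R N) → z ∈ I ^ (n + 1) • (⊤ : Submodule R N)

variable [IsNoetherianRing R] [Module.Finite R N]

lemma IsFilterRegular.isSMulRegular [IsLocalRing R] (h : IsFilterRegular I N a) (hI : I ≠ ⊤)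
    (hN : H0 I N = ⊥) : IsSMulRegular N a := by
  obtain ⟨n₀, h⟩ := h
  have key (z : N) (hz : z ∈ I ^ n₀ • (⊤ : Submodule R N)) (haz : a • z = 0) : z = 0 := by
    have hall (n : ℕ) (hn : n₀ ≤ n) : z ∈ I ^ n • (⊤ : Submodule R N) := by
      induction n, hn using Nat.le_induction with
      | base => exact hz
      | succ n hn ih => exact h n hn z ih (haz ▸ zero_mem _)
    rw [← Submodule.mem_bot R, ← Ideal.iInf_pow_smul_eq_bot_of_isLocalRing (M := N) I hI,
      Submodule.mem_iInf]
    exact fun n => pow_smul_top_mono (le_max_left n n₀) (hall _ (le_max_right n n₀))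
  refine (isSMulRegular_iff_right_eq_zero_of_smul).mpr fun z hz => ?_
  rw [← Submodule.mem_bot R, ← hN, mem_H0_iff]
  refine ⟨n₀, fun r hr => key _ (Submodule.smul_mem_smul hr Submodule.mem_top) ?_⟩
  rw [smul_comm, hz, smul_zero]

lemma IsFilterRegular.exists_mem_of_smul_mem (h : IsFilterRegular I N a)
    (hreg : IsSMulRegular N a) :
    ∃ n₁, ∀ n ≥ n₁, ∀ v : N, a • v ∈ I ^ (n + 1) • (⊤ : Submodule R N) →
      v ∈ I ^ n • (⊤ : Submodule R N) := by
  obtain ⟨n₀, h⟩ := h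
  obtain ⟨k, hk⟩ := I.exists_pow_inf_eq_pow_smul (LinearMap.range (LinearMap.lsmul R N a))
  refine ⟨n₀ + k, fun n hn v hv => ?_⟩
  have hv' : v ∈ I ^ (n + 1 - k) • (⊤ : Submodule R N) := by
    have h1 : a • v ∈ I ^ (n + 1) • ⊤ ⊓ LinearMap.range (LinearMap.lsmul R N a) := ⟨hv, v, rfl⟩
    rw [hk _ (by omega)] at h1
    have h2 := (Submodule.smul_mono le_rfl inf_le_right : _ ≤ I ^ (n + 1 - k) •
      LinearMap.range (LinearMap.lsmul R N a)) h1
    rw [LinearMap.range_eq_map, ← Submodule.map_smul''] at h2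
    obtain ⟨w, hw, hwv⟩ := h2
    exact hreg hwv ▸ hw
  have hind (j : ℕ) (hj : n + 1 - k ≤ j) : j ≤ n → v ∈ I ^ j • (⊤ : Submodule R N) := by
    induction j, hj using Nat.le_induction with
    | base => exact fun _ => hv'
    | succ j hj ih =>
      exact fun hjn => h j (by omega) v (ih (by omega)) (pow_smul_top_mono (by omega) hv)
  exact pow_smul_top_mono (le_max_left n _) (by
    rcases le_total n (n + 1 - k) with hle | hle
    · rwa [max_eq_right hle]
    · rw [max_eq_left hle]
      exact hind n hle le_rfl)

/-- For a general element `a` of `I`, the lengths of `H⁰_𝔪(IⁿN/Iⁿ⁺¹N)` have, for `n` large, the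
corresponding lengths of `N/aN` as their first difference. -/
lemma generic_h0Length_add_one [IsLocalRing R] [Infinite (IsLocalRing.ResidueField R)]
    (hI : I ≠ ⊤) (hN : H0 I N = ⊥) {m : ℕ} (u : Fin m → R) (hu : Ideal.span (Set.range u) = I) :
    Generic fun c : Fin m → R => IsSMulRegular N (∑ l, c l * u l) ∧ ∃ n₁ : ℕ, ∀ n ≥ n₁,
      h0Length (IsLocalRing.maximalIdeal R) I N (n + 1) =
        h0Length (IsLocalRing.maximalIdeal R) I N n +
        h0Length (IsLocalRing.maximalIdeal R) I
          (N ⧸ (Ideal.span {∑ l, c l * u l} • ⊤ : Submodule R N)) (n + 1) := by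
  set 𝔪 := IsLocalRing.maximalIdeal R
  obtain ⟨b, hb𝔪, t, hb⟩ := (saturFiltration I N 𝔪).exists_mem_forall_smul_mem 𝔪
  replace hb (n : ℕ) (z : N) (hz : z ∈ I ^ n • (⊤ : Submodule R N))
      (hbz : b • z ∈ satur 𝔪 (I ^ (n + 1) • (⊤ : Submodule R N))) :
      z ∈ satur 𝔪 (I ^ (n + 1) • (⊤ : Submodule R N)) :=
    mem_satur_of_forall_smul_mem_satur t (hb n z hz hbz)
  refine (((succFiltration I N).generic_mem_of_smul_mem u hu).and
    ((saturSupFiltration I N 𝔪 b).generic_mem_of_smul_mem u hu)).mono ?_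
  intro c
  have haI : ∑ l, c l * u l ∈ I :=
    Ideal.sum_mem _ fun l _ => Ideal.mul_mem_left _ _ (hu ▸ Ideal.subset_span ⟨l, rfl⟩)
  generalize ∑ l, c l * u l = a at haI ⊢
  rintro ⟨hfr : IsFilterRegular I N a, n₃, h₃⟩
  have hreg := hfr.isSMulRegular hI hN
  refine ⟨hreg, ?_⟩
  obtain ⟨n₂, h₂⟩ := hfr.exists_mem_of_smul_mem hreg
  obtain ⟨n₀, h₀⟩ := hfr
  refine ⟨max n₀ (max n₂ n₃), fun n hn => ?_⟩
  specialize h₀ n (by omega)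
  specialize h₂ n (by omega)
  specialize h₃ n (by omega)
  set K : Submodule R N := Ideal.span {a} • ⊤ with hK
  have hmemK (z : N) : z ∈ K ↔ ∃ v : N, a • v = z := by
    rw [hK, Submodule.ideal_span_singleton_smul, Submodule.mem_smul_pointwise_iff_exists]
    simp
  have hbpow (k : ℕ) (z : N) (hz : z ∈ I ^ (n + 1) • (⊤ : Submodule R N))
      (hbz : ∃ w ∈ satur 𝔪 (I ^ (n + 2) • (⊤ : Submodule R N)),
        ∃ v ∈ I ^ n • (⊤ : Submodule R N), b ^ k • z = w + a • v) :
      ∃ w ∈ satur 𝔪 (I ^ (n + 2) • (⊤ : Submodule R N)),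
        ∃ v ∈ I ^ n • (⊤ : Submodule R N), z = w + a • v := by
    induction k with
    | zero => simpa using hbz
    | succ k ih =>
      obtain ⟨w, hw, v, hv, hzwv⟩ := hbz
      have hbk : b ^ k • z ∈ I ^ (n + 1) • (⊤ : Submodule R N) := Submodule.smul_mem _ _ hz
      rw [pow_succ', mul_smul] at hzwv
      have hav : a • v ∈ (saturSupFiltration I N 𝔪 b).N (n + 1) := by
        rw [← sub_eq_of_eq_add' hzwv]
        exact sub_mem (Submodule.mem_sup_left ⟨_, hbk, rfl⟩) (Submodule.mem_sup_right hw)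
      obtain ⟨_, ⟨v', hv', rfl⟩, e, he, hve⟩ := Submodule.mem_sup.mp (h₃ v hv hav)
      refine ih ⟨b ^ k • z - a • v', hb (n + 1) _ (sub_mem hbk (smul_mem_pow_succ_smul haI hv')) ?_,
        v', hv', by abel⟩
      have : b • (b ^ k • z - a • v') = w + a • e := by
        rw [smul_sub, hzwv, ← hve, LinearMap.lsmul_apply, smul_add, smul_comm b a]
        abel
      rw [this]
      exact add_mem hw (smul_mem_satur_pow_succ haI he)
  have hlsmul (k : ℕ) (z : N) (hz : z ∈ I ^ k • (⊤ : Submodule R N)) :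
      LinearMap.lsmul R N a z ∈ I ^ (k + 1) • (⊤ : Submodule R N) :=
    smul_mem_pow_succ_smul haI hz
  refine mLength_H0_eq_add 𝔪
    (gradedPiece.map (LinearMap.lsmul R N a) (hlsmul n) (hlsmul (n + 1)))
    (gradedPiece.map K.mkQ (map_mem_pow_smul_top _ _) (map_mem_pow_smul_top _ _)) ?_ ?_ ?_
  · rw [injective_iff_map_eq_zero]
    intro g hg
    obtain ⟨z, hz, rfl⟩ := gradedPiece.mk_surjective g
    rw [gradedPiece.map_mk, gradedPiece.mk_eq_zero_iff] at hg
    exact gradedPiece.mk_eq_zero_iff.mpr (h₀ z hz hg)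
  · intro g
    obtain ⟨z, hz, rfl⟩ := gradedPiece.mk_surjective g
    rw [gradedPiece.map_mk, gradedPiece.mk_eq_zero_iff, mkQ_mem_pow_smul_iff]
    constructor
    · rintro ⟨w, hw, hzw⟩
      obtain ⟨v, hv⟩ := (hmemK _).mp hzw
      have hvn : v ∈ I ^ n • (⊤ : Submodule R N) :=
        h₂ v (hv ▸ sub_mem hz (pow_smul_top_mono (n + 1).le_succ hw))
      refine ⟨gradedPiece.mk v hvn, ?_⟩
      rw [gradedPiece.map_mk, gradedPiece.mk_eq_mk_iff, LinearMap.lsmul_apply, hv]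
      simpa using hw
    · rintro ⟨g, hg⟩
      obtain ⟨v, hv, rfl⟩ := gradedPiece.mk_surjective g
      rw [gradedPiece.map_mk, gradedPiece.mk_eq_mk_iff, LinearMap.lsmul_apply] at hg
      exact ⟨z - a • v, by simpa using neg_mem hg, (hmemK _).mpr ⟨v, by abel⟩⟩
  · intro g hg
    obtain ⟨z', hz', rfl⟩ := gradedPiece.mk_surjective g
    obtain ⟨z, hz, rfl⟩ := exists_mem_pow_smul_of_mkQ K z' hz'
    rw [gradedPiece.mk_mem_H0_iff] at hg
    obtain ⟨k, hk⟩ := mem_satur_iff.mp hg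
    have hbk := hk (b ^ k) (Ideal.pow_mem_pow hb𝔪 k)
    rw [← map_smul, mkQ_mem_pow_smul_iff] at hbk
    obtain ⟨w, hw, hzw⟩ := hbk
    obtain ⟨v, hv⟩ := (hmemK _).mp hzw
    have hvn : v ∈ I ^ n • (⊤ : Submodule R N) :=
      h₂ v (hv ▸ sub_mem (Submodule.smul_mem _ _ hz) (pow_smul_top_mono (n + 1).le_succ hw))
    obtain ⟨w', hw', v', hv', hz'⟩ := hbpow k z hz
      ⟨w, le_satur _ _ hw, v, hvn, by rw [hv]; abel⟩
    have hw'z : w' ∈ I ^ (n + 1) • (⊤ : Submodule R N) := by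
      rw [← sub_eq_of_eq_add hz']
      exact sub_mem hz (smul_mem_pow_succ_smul haI hv')
    refine ⟨gradedPiece.mk w' hw'z, gradedPiece.mk_mem_H0_iff.mpr hw', ?_⟩
    rw [gradedPiece.map_mk, gradedPiece.mk_eq_mk_iff]
    have : K.mkQ w' - K.mkQ z = 0 := by
      rw [← map_sub]
      exact (Submodule.Quotient.mk_eq_zero K).mpr ((hmemK _).mpr ⟨-v', by rw [hz', smul_neg]; abel⟩)
    rw [this]
    exact zero_mem _

end Superficial

/-- A sequence whose difference sequence is asymptotic to `c nᵉ` is asymptotic to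
`c/(e+1) nᵉ⁺¹`. -/
lemma tendsto_div_pow_succ_of_tendsto_sub {f g : ℕ → ℝ} {c : ℝ} (e : ℕ)
    (hfg : ∀ᶠ n in atTop, f (n + 1) = f n + g (n + 1))
    (hg : Tendsto (fun n : ℕ => g n / (n : ℝ) ^ e) atTop (nhds c)) :
    Tendsto (fun n : ℕ => f n / (n : ℝ) ^ (e + 1)) atTop (nhds (c / (e + 1))) := by
  let G : ℕ → ℝ := fun n => ((n + 1 : ℕ) : ℝ) ^ (e + 1) - (n : ℝ) ^ (e + 1)
  have hGsum (n : ℕ) : ∑ i ∈ Finset.range n, G i = (n : ℝ) ^ (e + 1) := by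
    rw [Finset.sum_range_sub (fun i : ℕ => (i : ℝ) ^ (e + 1))]
    simp
  have hGpos (n : ℕ) : 0 < G n :=
    sub_pos.mpr (pow_lt_pow_left₀ (by simp) (by positivity) (by omega))
  have hGlim : Tendsto (fun n : ℕ => G n / ((n + 1 : ℕ) : ℝ) ^ e) atTop (nhds (e + 1)) := by
    have h (n : ℕ) : G n / ((n + 1 : ℕ) : ℝ) ^ e =
        ∑ i ∈ Finset.range (e + 1), ((n : ℝ) / (n + 1)) ^ (e - i) := by
      have hgeom := (Commute.all ((n + 1 : ℕ) : ℝ) (n : ℝ)).geom_sum₂_mul (e + 1)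
      have hone : ((n + 1 : ℕ) : ℝ) - n = 1 := by push_cast; ring
      rw [hone, mul_one] at hgeom
      have hn : (n : ℝ) + 1 ≠ 0 := by positivity
      simp only [G]
      rw [← hgeom, Finset.sum_div]
      refine Finset.sum_congr rfl fun i hi => ?_
      obtain ⟨j, rfl⟩ := Nat.exists_eq_add_of_le (Nat.lt_succ_iff.mp (Finset.mem_range.mp hi))
      rw [show i + j + 1 - 1 - i = j by omega, show i + j - i = j by omega, div_pow, pow_add]
      push_cast
      field_simp
    simp only [h]
    have := tendsto_finsetSum (Finset.range (e + 1)) fun i _ =>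
      (tendsto_natCast_div_add_atTop (1 : ℝ)).pow (e - i)
    simpa using this
  have hratio : Tendsto (fun n : ℕ => (f (n + 1) - f n) / G n) atTop (nhds (c / (e + 1))) := by
    refine ((hg.comp (tendsto_add_atTop_nat 1)).div hGlim (by positivity)).congr' ?_
    filter_upwards [hfg] with n hn
    have hn' : ((n + 1 : ℕ) : ℝ) ^ e ≠ 0 := by positivity
    have := (hGpos n).ne'
    simp only [Pi.div_apply, Function.comp_apply]
    rw [hn, add_sub_cancel_left, div_div_div_cancel_right₀ hn']
  have hlittle : (fun n : ℕ => f (n + 1) - f n - c / (e + 1) * G n) =o[atTop] G := by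
    refine (Asymptotics.isLittleO_iff_tendsto fun n hn => absurd hn (hGpos n).ne').mpr ?_
    have := hratio.sub_const (c / (e + 1))
    rw [sub_self] at this
    refine this.congr fun n => ?_
    have := (hGpos n).ne'
    field_simp
  have hpow : Tendsto (fun n : ℕ => (n : ℝ) ^ (e + 1)) atTop atTop :=
    (tendsto_pow_atTop (by omega)).comp tendsto_natCast_atTop_atTop
  have hsum := hlittle.sum_range (fun n => (hGpos n).le) (by simpa only [hGsum] using hpow)
  have hfsum (n : ℕ) : ∑ i ∈ Finset.range n, (f (i + 1) - f i - c / (e + 1) * G i) =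
      f n - f 0 - c / (e + 1) * (n : ℝ) ^ (e + 1) := by
    rw [Finset.sum_sub_distrib, ← Finset.mul_sum, hGsum, Finset.sum_range_sub]
  simp only [hfsum, hGsum] at hsum
  have hlim := hsum.tendsto_div_nhds_zero.add
    ((tendsto_const_nhds (x := f 0)).div_atTop hpow) |>.add_const (c / (e + 1))
  rw [zero_add, zero_add] at hlim
  refine hlim.congr' ?_
  filter_upwards [eventually_gt_atTop 0] with n hn
  have : (n : ℝ) ^ (e + 1) ≠ 0 := by positivity
  field_simp
  ring

section Saturation

variable {R N : Type*} [CommRing R] [AddCommGroup N] [Module R N]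

lemma satur_bot (I : Ideal R) : satur I (⊥ : Submodule R N) = H0 I N := by
  ext x
  simp [mem_satur_iff, mem_H0_iff]

variable [IsNoetherianRing R]

lemma H0_quotient_satur_bot (I : Ideal R) : H0 I (N ⧸ satur I (⊥ : Submodule R N)) = ⊥ := by
  refine eq_bot_iff.mpr fun x hx => ?_
  obtain ⟨z, rfl⟩ := Submodule.mkQ_surjective _ x
  obtain ⟨k, hk⟩ := mem_H0_iff.mp hx
  exact (Submodule.Quotient.mk_eq_zero _).mpr (mem_satur_of_forall_smul_mem_satur k fun r hr =>
    (Submodule.Quotient.mk_eq_zero _).mp (hk r hr))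

lemma h0Length_quotient_satur_bot [Module.Finite R N] (J I : Ideal R) :
    ∀ᶠ n in atTop,
      h0Length J I N n = h0Length J I (N ⧸ satur I (⊥ : Submodule R N)) n := by
  set L := satur I (⊥ : Submodule R N) with hL
  obtain ⟨k, hk⟩ := I.exists_pow_inf_eq_pow_smul L
  obtain ⟨t, ht⟩ := exists_pow_smul_H0_eq_zero (P := N) I
  filter_upwards [eventually_ge_atTop (k + t)] with n hn
  have hinf (z : N) (hz : z ∈ I ^ n • (⊤ : Submodule R N)) (hzL : z ∈ L) : z = 0 := by
    have h : z ∈ I ^ n • ⊤ ⊓ L := ⟨hz, hzL⟩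
    rw [hk n (by omega)] at h
    have h' := Submodule.smul_mono (Ideal.pow_le_pow_right (show t ≤ n - k by omega))
      inf_le_right h
    rw [hL, satur_bot] at h'
    rw [← Submodule.mem_bot R]
    exact (Submodule.smul_le (P := ⊥)).mpr (fun r hr x hx => by simpa using ht r hr x hx) h'
  refine mLength_H0_congr J (LinearEquiv.ofBijective
    (gradedPiece.map L.mkQ (map_mem_pow_smul_top _ _) (map_mem_pow_smul_top _ _)) ⟨?_, ?_⟩)
  · rw [injective_iff_map_eq_zero]
    intro g hg
    obtain ⟨z, hz, rfl⟩ := gradedPiece.mk_surjective g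
    rw [gradedPiece.map_mk, gradedPiece.mk_eq_zero_iff, mkQ_mem_pow_smul_iff] at hg
    obtain ⟨w, hw, hzw⟩ := hg
    have := hinf _ (sub_mem hz (pow_smul_top_mono n.le_succ hw)) hzw
    exact gradedPiece.mk_eq_zero_iff.mpr (sub_eq_zero.mp this ▸ hw)
  · intro g
    obtain ⟨z', hz', rfl⟩ := gradedPiece.mk_surjective g
    obtain ⟨z, hz, rfl⟩ := exists_mem_pow_smul_of_mkQ L z' hz'
    exact ⟨gradedPiece.mk z hz, rfl⟩

end Saturation

section Dimension

variable {R N : Type*} [CommRing R] [AddCommGroup N] [Module R N]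

lemma exists_maximalIdeal_pow_le_annihilator [IsNoetherianRing R] [IsLocalRing R]
    (h : mDim R N ≤ 0) : ∃ k, IsLocalRing.maximalIdeal R ^ k ≤ Module.annihilator R N := by
  have hmax := Ideal.krullDimLE_zero_quotient_iff_forall_minimalPrimes_isMaximal.mp
    (Ring.krullDimLE_iff.mpr h : Ring.KrullDimLE 0 (R ⧸ Module.annihilator R N))
  refine Ideal.exists_pow_le_of_le_radical_of_fg ?_ (IsNoetherian.noetherian _)
  rw [← Ideal.sInf_minimalPrimes]
  exact le_sInf fun J hJ => (IsLocalRing.eq_maximalIdeal (hmax J hJ)).ge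

lemma h0Length_eq_zero_of_mDim_le_zero [IsNoetherianRing R] [IsLocalRing R] (J : Ideal R)
    {I : Ideal R} (hI : I ≠ ⊤) (h : mDim R N ≤ 0) : ∀ᶠ n in atTop, h0Length J I N n = 0 := by
  obtain ⟨k, hk⟩ := exists_maximalIdeal_pow_le_annihilator h
  filter_upwards [eventually_ge_atTop k] with n hn
  have hzero : I ^ n • (⊤ : Submodule R N) = ⊥ := by
    refine eq_bot_iff.mpr (Submodule.smul_le.mpr fun r hr z _ => ?_)
    exact Module.mem_annihilator.mp (hk (Ideal.pow_right_mono (IsLocalRing.le_maximalIdeal hI) k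
      (Ideal.pow_le_pow_right hn hr))) z
  have : Subsingleton (gradedPiece I (M := N) n) := by
    refine Submodule.subsingleton_iff_eq_bot.mpr ?_
    rw [gradedPiece, hzero, Submodule.map_bot]
  rw [h0Length, mLength_eq_length, Module.length_eq_zero]

variable [Module.Finite R N]

lemma mDim_eq_supportDim : mDim R N = Module.supportDim R N :=
  (Module.supportDim_eq_ringKrullDim_quotient_annihilator R N).symm

lemma mDim_quotient_le (K : Submodule R N) : mDim R (N ⧸ K) ≤ mDim R N := by
  rw [mDim_eq_supportDim, mDim_eq_supportDim]
  exact Module.supportDim_le_of_surjective K.mkQ K.mkQ_surjective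

variable [IsNoetherianRing R] [IsLocalRing R]

lemma mDim_quotient_smul_top_le {a : R} (ha : a ∈ IsLocalRing.maximalIdeal R)
    (hreg : IsSMulRegular N a) {e : ℕ} (h : mDim R N ≤ ((e + 1 : ℕ) : WithBot ℕ∞)) :
    mDim R (N ⧸ (Ideal.span {a} • ⊤ : Submodule R N)) ≤ (e : WithBot ℕ∞) := by
  rw [mDim_eq_supportDim] at h ⊢
  rw [Submodule.ideal_span_singleton_smul]
  rw [← Module.supportDim_quotSMulTop_succ_eq_supportDim hreg ha] at h
  exact ENat.WithBot.add_le_add_one_right_iff.mp (by exact_mod_cast h)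

end Dimension

section Limit

variable {R : Type*} [CommRing R] [IsNoetherianRing R] [IsLocalRing R]

lemma h0Length_ne_top (I : Ideal R) (N : Type*) [AddCommGroup N] [Module R N] [Module.Finite R N]
    (n : ℕ) : h0Length (IsLocalRing.maximalIdeal R) I N n ≠ ⊤ :=
  mLength_H0_ne_top

/-- If the lengths of `H⁰_𝔪(IⁿN'/Iⁿ⁺¹N')` are eventually the first differences of those of `N`,
an asymptotic estimate for the former integrates to one for the latter. -/
lemma tendsto_h0Length_div_pow_succ {I : Ideal R} {N N' : Type*} [AddCommGroup N] [Module R N]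
    [Module.Finite R N] [AddCommGroup N'] [Module R N'] [Module.Finite R N'] {e n₁ : ℕ} {c : ℝ}
    (h : ∀ n ≥ n₁, h0Length (IsLocalRing.maximalIdeal R) I N (n + 1) =
      h0Length (IsLocalRing.maximalIdeal R) I N n +
      h0Length (IsLocalRing.maximalIdeal R) I N' (n + 1))
    (hN' : Tendsto (fun n : ℕ => ((h0Length (IsLocalRing.maximalIdeal R) I N' n).toNat : ℝ) /
      (n : ℝ) ^ e) atTop (nhds c)) :
    Tendsto (fun n : ℕ => ((h0Length (IsLocalRing.maximalIdeal R) I N n).toNat : ℝ) /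
      (n : ℝ) ^ (e + 1)) atTop (nhds (c / (e + 1))) := by
  refine tendsto_div_pow_succ_of_tendsto_sub e ?_ hN'
  filter_upwards [eventually_ge_atTop n₁] with n hn
  rw [h n hn, ENat.toNat_add (h0Length_ne_top I N n) (h0Length_ne_top I N' (n + 1)), Nat.cast_add]

variable [Infinite (IsLocalRing.ResidueField R)]

/-- The limit defining the `j`-multiplicity exists. -/
lemma exists_tendsto_h0Length_div_pow {I : Ideal R} (hI : I ≠ ⊤) (e : ℕ) (N : Type*)
    [AddCommGroup N] [Module R N] [Module.Finite R N]
    (hdim : mDim R N ≤ ((e + 1 : ℕ) : WithBot ℕ∞)) :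
    ∃ c : ℝ, Tendsto (fun n : ℕ => ((h0Length (IsLocalRing.maximalIdeal R) I N n).toNat : ℝ) /
      (n : ℝ) ^ e) atTop (nhds c) := by
  set N₀ := N ⧸ satur I (⊥ : Submodule R N)
  suffices h : ∃ c : ℝ, Tendsto (fun n : ℕ =>
      ((h0Length (IsLocalRing.maximalIdeal R) I N₀ n).toNat : ℝ) / (n : ℝ) ^ e)
      atTop (nhds c) by
    refine h.imp fun c hc => hc.congr' ?_
    filter_upwards [h0Length_quotient_satur_bot (N := N) (IsLocalRing.maximalIdeal R) I] with n hn
    rw [hn]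
  obtain ⟨m, u, hu⟩ := Submodule.fg_iff_exists_fin_generating_family.mp (IsNoetherian.noetherian I)
  obtain ⟨c, hreg, n₁, hn₁⟩ :=
    (generic_h0Length_add_one hI (H0_quotient_satur_bot (N := N) I) u hu).exists_of_infinite
  have haI : ∑ l, c l * u l ∈ I :=
    Ideal.sum_mem _ fun l _ => Ideal.mul_mem_left _ _ (hu ▸ Ideal.subset_span ⟨l, rfl⟩)
  have hdim' := mDim_quotient_smul_top_le (IsLocalRing.le_maximalIdeal hI haI) hreg
    ((mDim_quotient_le _).trans hdim)
  cases e with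
  | zero =>
    obtain ⟨n₂, hn₂⟩ := eventually_atTop.mp (h0Length_eq_zero_of_mDim_le_zero
      (IsLocalRing.maximalIdeal R) hI hdim')
    refine ⟨((h0Length (IsLocalRing.maximalIdeal R) I N₀ (max n₁ n₂)).toNat : ℝ),
      tendsto_const_nhds.congr' ?_⟩
    filter_upwards [eventually_ge_atTop (max n₁ n₂)] with n hn
    rw [pow_zero, div_one]
    induction n, hn using Nat.le_induction with
    | base => rfl
    | succ n hn ih => rw [hn₁ n (by omega), hn₂ (n + 1) (by omega), add_zero, ih]
  | succ e =>
    obtain ⟨c, hc⟩ := exists_tendsto_h0Length_div_pow hI e _ hdim'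
    exact ⟨_, tendsto_h0Length_div_pow_succ hn₁ hc⟩

end Limit

lemma jMult_eq_of_tendsto {R : Type*} [CommRing R] {J I : Ideal R} {N : Type*} [AddCommGroup N]
    [Module R N] {d : ℕ} {c : ℝ}
    (h : Tendsto (fun n : ℕ => ((h0Length J I N n).toNat : ℝ) / (n : ℝ) ^ (d - 1)) atTop (nhds c)) :
    jMult J I N d = (d - 1).factorial * c := by
  refine Tendsto.limUnder_eq ((h.const_mul _).congr fun n => ?_)
  rw [h0Length]
  ring

lemma Generic.generalElts {R : Type*} [CommRing R] [IsLocalRing R] {I : Ideal R} {P : R → Prop}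
    (h : ∀ (m : ℕ) (u : Fin m → R), Ideal.span (Set.range u) = I →
      Generic fun c : Fin m → R => P (∑ l, c l * u l)) :
    GeneralElts (IsLocalRing.maximalIdeal R) I 1 fun a => P (a 0) := by
  intro m u hu
  obtain ⟨F, hF, h⟩ := h m u hu
  refine ⟨F.rename fun l => (0, l), ?_, fun c hc => ?_⟩
  · rw [MvPolynomial.map_rename, Ne, MvPolynomial.rename_eq_zero_iff_of_injective]
    · exact hF
    · exact fun l l' hl => congrArg Prod.snd hl
  · rw [MvPolynomial.map_rename, MvPolynomial.eval_rename] at hc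
    exact h _ hc

/-- Lemma 3.4: with `M̄ = M/(0 :_M I^∞)`, for a general element `a ∈ I` one has
`dim (M̄/aM̄) ≤ d−1` and `j_d(I, M) = j_{d−1}(I, M̄/aM̄)`. -/
theorem stmt_8 {R : Type*} [CommRing R] [IsNoetherianRing R] [IsLocalRing R]
    (hdim : 0 < ringKrullDim R) (hres : Infinite (IsLocalRing.ResidueField R))
    (I : Ideal R) (hI : I ≠ ⊤)
    (M : Type*) [AddCommGroup M] [Module R M] [Module.Finite R M]
    (d : ℕ) (hd : 2 ≤ d) (hMd : mDim R M ≤ (d : WithBot ℕ∞)) :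
    GeneralElts (IsLocalRing.maximalIdeal R) I 1 fun a =>
      mDim R ((M ⧸ satur I (⊥ : Submodule R M)) ⧸
          (Ideal.span {a 0} • ⊤ : Submodule R (M ⧸ satur I (⊥ : Submodule R M)))) ≤
        ((d - 1 : ℕ) : WithBot ℕ∞) ∧
      jMult (IsLocalRing.maximalIdeal R) I M d =
        jMult (IsLocalRing.maximalIdeal R) I
          ((M ⧸ satur I (⊥ : Submodule R M)) ⧸
            (Ideal.span {a 0} • ⊤ : Submodule R (M ⧸ satur I (⊥ : Submodule R M)))) (d - 1) := by
  obtain ⟨e, rfl⟩ := Nat.exists_eq_add_of_le' hd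
  refine Generic.generalElts (P := fun a => mDim R ((M ⧸ satur I (⊥ : Submodule R M)) ⧸
      (Ideal.span {a} • ⊤ : Submodule R (M ⧸ satur I (⊥ : Submodule R M)))) ≤
        ((e + 2 - 1 : ℕ) : WithBot ℕ∞) ∧
      jMult (IsLocalRing.maximalIdeal R) I M (e + 2) =
        jMult (IsLocalRing.maximalIdeal R) I
          ((M ⧸ satur I (⊥ : Submodule R M)) ⧸
            (Ideal.span {a} • ⊤ : Submodule R (M ⧸ satur I (⊥ : Submodule R M)))) (e + 2 - 1))
    fun m u hu => (generic_h0Length_add_one hI (H0_quotient_satur_bot (N := M) I) u hu).mono ?_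
  rintro c ⟨hreg, n₁, hn₁⟩
  have haI : ∑ l, c l * u l ∈ I :=
    Ideal.sum_mem _ fun l _ => Ideal.mul_mem_left _ _ (hu ▸ Ideal.subset_span ⟨l, rfl⟩)
  have hdim' := mDim_quotient_smul_top_le (IsLocalRing.le_maximalIdeal hI haI) hreg
    ((mDim_quotient_le _).trans hMd)
  refine ⟨hdim', ?_⟩
  obtain ⟨L, hL⟩ := exists_tendsto_h0Length_div_pow hI e _ hdim'
  have hM := (tendsto_h0Length_div_pow_succ hn₁ hL).congr' (f₂ := fun n : ℕ =>
      ((h0Length (IsLocalRing.maximalIdeal R) I M n).toNat : ℝ) / (n : ℝ) ^ (e + 1)) (by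
    filter_upwards [h0Length_quotient_satur_bot (N := M) (IsLocalRing.maximalIdeal R) I] with n hn
    rw [hn])
  rw [jMult_eq_of_tendsto (d := e + 2) hM, jMult_eq_of_tendsto (d := e + 2 - 1) hL]
  have : (e : ℝ) + 1 ≠ 0 := by positivity
  simp only [Nat.add_sub_cancel, show e + 2 - 1 = e + 1 by omega, Nat.factorial_succ]
  push_cast
  field_simp

end
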